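/- Let a ≥ 1 and b ≥ 0 be integers; let λ^(1), λ^(2), …, λ^(a) be partitions each of length at least two; and let D₁, D₂, …, D_b ≥ 2 be integers. Set ℓ_i = ℓ(λ^(i)) for 1 ≤ i ≤ a, L = ℓ₁ + … + ℓ_a, |λ| = |λ^(1)| + … + |λ^(a)|, and B = D₁ + … + D_b. Suppose additionally that there exists some j₀ ∈ {1,…,a} such that at least two parts of λ^(j₀) are ≥ 2. Then |⟨p_{λ^(1)} | p_{λ^(2)} | ⋯ | p_{λ^(a)} | p_{D₁} | p_{D₂} | ⋯ | p_{D_b}⟩| ≤ 2^{89L+5} · (|λ| + a + B − L − 1)!. -/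

import Mathlib

open Nat Finset

attribute [local instance] Classical.propDecidable

/-- The series `ζ(k) = Σ_{j=1}^∞ j^{−k}` (convergent for `k ≥ 2`). -/
noncomputable def zetaSeries (k : ℤ) : ℝ :=
  ∑' j : ℕ, ((j : ℝ) + 1) ^ (-k)

/-- `𝔷(k) = (2 − 2^{2−k}) ζ(k)` for even integers `k ≥ 2`, `𝔷(0) = 1`, and `𝔷(k) = 0`
for all other integers `k` (in particular for odd or negative `k`). -/
noncomputable def zed (k : ℤ) : ℝ :=
  if k = 0 then 1
  else if 2 ≤ k ∧ Even k then (2 - (2 : ℝ) ^ (2 - k)) * zetaSeries k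
  else 0

/-- `P` is a (reduced) set partition of the finite set `S`: a collection of nonempty
disjoint subsets of `S` whose union is `S` (each element of `S` lies in exactly one
component). -/
def IsSetPartitionOn {ι : Type*} [DecidableEq ι] (S : Finset ι) (P : Finset (Finset ι)) :
    Prop :=
  (∀ s ∈ P, s ⊆ S ∧ s ≠ ∅) ∧ ∀ x ∈ S, ∃! s, s ∈ P ∧ x ∈ s

/-- `P` refines `Q`: every component of `P` is contained in a component of `Q`. -/
def Refines {ι : Type*} (P Q : Finset (Finset ι)) : Prop :=
  ∀ s ∈ P, ∃ t ∈ Q, s ⊆ t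

/-- Two set partitions `α`, `β` of a finite type `ι` (with `n = |ι|` elements) are
complementary if `ℓ(α) + ℓ(β) = n + 1` and the minimal set partition refined by both
`α` and `β` is the maximal (one-component) set partition; equivalently, the only common
coarsening of `α` and `β` is the one-component partition. -/
def IsComplementary {ι : Type*} [Fintype ι] [DecidableEq ι]
    (α β : Finset (Finset ι)) : Prop :=
  α.card + β.card = Fintype.card ι + 1 ∧
    ∀ γ : Finset (Finset ι), IsSetPartitionOn Finset.univ γ →
      Refines α γ → Refines β γ → γ = {Finset.univ}

/-- The quantity `E(m)` of Eskin–Okounkov, for a weight function `v` on a finite ground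
set `S`:
`E = Σ_{P partition of S, ℓ(P) ≥ 2} (−1)^{ℓ(P)−1} (ℓ(P)−2)!
      Σ_{d : P → ℕ, Σ d = ℓ(P)−2} ∏_{s ∈ P} (1/d_s!) · |v_s|! · 𝔷(|v_s| − |s| − d_s + 1)`,
where `|v_s| = Σ_{x ∈ s} v(x)` and `|s|` is the cardinality of the component `s`. -/
noncomputable def Emap {ι : Type*} [Fintype ι] [DecidableEq ι]
    (S : Finset ι) (v : ι → ℕ) : ℝ :=
  ∑ P ∈ Finset.univ.filter
      (fun P : Finset (Finset ι) => IsSetPartitionOn S P ∧ 2 ≤ P.card),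
    (-1 : ℝ) ^ (P.card - 1) * ((P.card - 2)! : ℝ) *
      ∑ d ∈ Finset.finsuppAntidiag P (P.card - 2),
        ∏ s ∈ P,
          (1 / ((d s)! : ℝ) * ((∑ x ∈ s, v x)! : ℝ) *
            zed ((∑ x ∈ s, v x : ℤ) - s.card - d s + 1))

/-- The single-bracket inner product `⟨m⟩ = |m|! · 𝔷(|m| − n + 2) + E(m)`, where the
entries of the tuple `m` are the values of `v` on the `n`-element ground set `S`. -/
noncomputable def innerSingle {ι : Type*} [Fintype ι] [DecidableEq ι]
    (S : Finset ι) (v : ι → ℕ) : ℝ :=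
  ((∑ x ∈ S, v x)! : ℝ) * zed ((∑ x ∈ S, v x : ℤ) - S.card + 2) + Emap S v

/-- The multi-fold inner product `⟨p_{λ^(1)} | ⋯ | p_{λ^(n)}⟩`.  The data of the
partitions `λ^(1), …, λ^(n)` is encoded by a ground set `ι` of size `L` (positions of
all parts), the value map `v : ι → ℕ` recording the parts, and the set partition `ρ`
of `ι` whose components group the positions belonging to the same `λ^(j)`.  Then
`⟨p_{λ^(1)} | ⋯ | p_{λ^(n)}⟩ = Σ_{α ∈ 𝒞(ρ)} ∏_{s ∈ α} ⟨λ_s⟩`, the sum running over set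
partitions `α` of `ι` complementary to `ρ`, where `λ_s` is the tuple of parts at the
positions in the component `s`. -/
noncomputable def innerMulti {ι : Type*} [Fintype ι] [DecidableEq ι]
    (ρ : Finset (Finset ι)) (v : ι → ℕ) : ℝ :=
  ∑ α ∈ Finset.univ.filter
      (fun α : Finset (Finset ι) =>
        IsSetPartitionOn Finset.univ α ∧ IsComplementary ρ α),
    ∏ s ∈ α, innerSingle s v

lemma summable_one_div_succ_zpow {k : ℤ} (hk : 2 ≤ k) :
    Summable fun j : ℕ => ((j : ℝ) + 1) ^ (-k) := by
  obtain ⟨n, rfl⟩ := Int.eq_ofNat_of_zero_le (by omega : 0 ≤ k)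
  have h := (summable_nat_add_iff 1).2 (Real.summable_nat_pow_inv.2 (by omega : 1 < n))
  simpa using h

lemma zetaSeries_nonneg (k : ℤ) : 0 ≤ zetaSeries k :=
  tsum_nonneg fun j => by positivity

lemma one_sub_mul_zetaSeries_le_one {k : ℤ} (hk : 2 ≤ k) :
    (1 - 2 * (2 : ℝ) ^ (-k)) * zetaSeries k ≤ 1 := by
  set f : ℕ → ℝ := fun j => ((j : ℝ) + 1) ^ (-k) with hf
  have hs : Summable f := summable_one_div_succ_zpow hk
  have he : Summable fun j => f (2 * j) := hs.comp_injective fun a b h => by simpa using h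
  have ho : Summable fun j => f (2 * j + 1) := hs.comp_injective fun a b h => by simpa using h
  have hsum := tsum_even_add_odd he ho
  have hodd : ∑' j, f (2 * j + 1) = 2 ^ (-k) * ∑' j, f j := by
    rw [← tsum_mul_left]
    congr 1
    ext j
    simp only [hf]
    rw [← mul_zpow]
    push_cast
    congr 1
    ring
  have heven : ∑' j, f (2 * j) ≤ 1 + ∑' j, f (2 * j + 1) := by
    rw [he.tsum_eq_zero_add]
    have h1 : Summable fun j => f (2 * (j + 1)) := (summable_nat_add_iff 1).2 he
    have h2 : ∑' j, f (2 * (j + 1)) ≤ ∑' j, f (2 * j + 1) := by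
      refine h1.tsum_le_tsum (fun j => ?_) ho
      simp only [hf]
      obtain ⟨n, rfl⟩ := Int.eq_ofNat_of_zero_le (by omega : 0 ≤ k)
      simp only [zpow_neg]
      push_cast
      gcongr ?_⁻¹
      exact pow_le_pow_left₀ (by positivity) (by linarith) n
    have h0 : f (2 * 0) = 1 := by simp [hf]
    linarith
  change _ * (∑' j, f j) ≤ 1
  linarith

lemma abs_zed_le_two (k : ℤ) : |zed k| ≤ 2 := by
  unfold zed
  split_ifs with h0 h
  · norm_num
  · have h2 := one_sub_mul_zetaSeries_le_one h.1
    have h3 : (2 : ℝ) ^ (2 - k) = 4 * 2 ^ (-k) := by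
      rw [sub_eq_add_neg, zpow_add₀ (by norm_num)]; norm_num
    have h4 : (2 : ℝ) ^ (2 - k) ≤ 1 := zpow_le_one_of_nonpos₀ (by norm_num) (by omega)
    rw [abs_of_nonneg (mul_nonneg (by linarith) (zetaSeries_nonneg k)), h3]
    linarith
  · norm_num

lemma ascFactorial_succ_left (n d : ℕ) :
    n.ascFactorial (d + 1) = n * (n + 1).ascFactorial d := by
  rw [Nat.ascFactorial_succ]
  exact (Nat.succ_ascFactorial n d).symm

lemma ascFactorial_le_ascFactorial_left {m n : ℕ} (h : m ≤ n) (d : ℕ) :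
    m.ascFactorial d ≤ n.ascFactorial d := by
  induction d with
  | zero => simp
  | succ d ih =>
    rw [Nat.ascFactorial_succ, Nat.ascFactorial_succ]
    gcongr

lemma ascFactorial_add_two_left (n d : ℕ) :
    n.ascFactorial (d + 2) = n * (n + 1) * (n + 2).ascFactorial d := by
  rw [ascFactorial_succ_left, ascFactorial_succ_left, mul_assoc]

section Arithmetic

variable {κ : Type*} (P : Finset κ) (W : κ → ℕ)

lemma sum_ascFactorial_succ_le {M : ℕ} (hW : ∀ t ∈ P, W t ≤ M) (e : ℕ) :
    ∑ t ∈ P, (W t + 1).ascFactorial (e + 1) ≤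
      (∑ t ∈ P, W t + P.card) * (M + 2).ascFactorial e := by
  have : ∑ t ∈ P, W t + P.card = ∑ t ∈ P, (W t + 1) := by simp [Finset.sum_add_distrib]
  rw [this, Finset.sum_mul]
  refine Finset.sum_le_sum fun t ht => ?_
  rw [ascFactorial_succ_left]
  exact Nat.mul_le_mul_left _ (ascFactorial_le_ascFactorial_left (by have := hW t ht; omega) e)

lemma sum_ascFactorial_add_two_le {M : ℕ} (hW : ∀ t ∈ P, W t ≤ M) (e : ℕ) :
    ∑ t ∈ P, (W t + 1).ascFactorial (e + 2) ≤
      (∑ t ∈ P, (W t + 1) * (W t + 2)) * (M + 3).ascFactorial e := by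
  rw [Finset.sum_mul]
  refine Finset.sum_le_sum fun t ht => ?_
  rw [ascFactorial_add_two_left]
  exact Nat.mul_le_mul_left _ (ascFactorial_le_ascFactorial_left (by have := hW t ht; omega) e)

lemma sum_mul_self_le_sum_mul_sum (x : κ → ℕ) :
    ∑ t ∈ P, x t * x t ≤ (∑ t ∈ P, x t) * ∑ t ∈ P, x t := by
  rw [Finset.sum_mul]
  exact Finset.sum_le_sum fun t ht =>
    Nat.mul_le_mul_left _ (Finset.single_le_sum (fun _ _ => Nat.zero_le _) ht)

lemma sum_succ_mul_add_two (x : κ → ℕ) (hx : ∀ t ∈ P, W t = x t + 1) :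
    ∑ t ∈ P, (W t + 1) * (W t + 2) =
      ∑ t ∈ P, x t * x t + 5 * ∑ t ∈ P, x t + 6 * P.card := by
  have : 6 * P.card = ∑ t ∈ P, 6 := by simp [mul_comm]
  rw [this, Finset.mul_sum, ← Finset.sum_add_distrib, ← Finset.sum_add_distrib]
  refine Finset.sum_congr rfl fun t ht => ?_
  rw [hx t ht]
  ring

lemma sum_eq_sum_pred_add_card (hW : ∀ t ∈ P, 1 ≤ W t) :
    ∑ t ∈ P, W t = ∑ t ∈ P, (W t - 1) + P.card := by
  have : P.card = ∑ t ∈ P, 1 := by simp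
  rw [this, ← Finset.sum_add_distrib]
  exact Finset.sum_congr rfl fun t ht => by have := hW t ht; omega

lemma sum_succ_mul_add_two_le (hP : P.Nonempty) (hW : ∀ t ∈ P, 1 ≤ W t) :
    ∑ t ∈ P, (W t + 1) * (W t + 2) + 16 * P.card ≤
      (∑ t ∈ P, W t + 1) * (∑ t ∈ P, W t + 2) + 88 := by
  rw [sum_succ_mul_add_two P W (fun t => W t - 1) fun t ht => by have := hW t ht; omega,
    sum_eq_sum_pred_add_card P W hW]
  have h1 := sum_mul_self_le_sum_mul_sum P fun t => W t - 1
  have h2 := hP.card_pos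
  generalize (∑ t ∈ P, (W t - 1)) = X at *
  generalize (∑ t ∈ P, (W t - 1) * (W t - 1)) = Y at *
  generalize P.card = r at *
  obtain ⟨s, rfl⟩ := Nat.exists_eq_add_of_le' h2
  have h3 : 17 * s ≤ s * s + 72 := by
    rcases le_total s 9 with h | h
    · interval_cases s <;> norm_num
    · nlinarith
  have h4 := Nat.zero_le (X * s)
  nlinarith

lemma sum_ascFactorial_add_factorial_le (hW : ∀ t ∈ P, 1 ≤ W t) (e : ℕ) :
    ∑ t ∈ P, (W t + 1).ascFactorial (e + 1) + 8 * P.card * (e + 1)! ≤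
      10 * (∑ t ∈ P, W t + 1).ascFactorial (e + 1) := by
  have h1 := sum_ascFactorial_succ_le P W
    (fun t ht => Finset.single_le_sum (f := W) (fun _ _ => Nat.zero_le _) ht) e
  have h2 := sum_eq_sum_pred_add_card P W hW
  rw [← Nat.one_ascFactorial, ascFactorial_succ_left 1, ascFactorial_succ_left (_ + 1)]
  have h3 := ascFactorial_le_ascFactorial_left (by omega : 1 + 1 ≤ ∑ t ∈ P, W t + 1 + 1) e
  calc _ ≤ (∑ t ∈ P, W t + P.card) * (∑ t ∈ P, W t + 1 + 1).ascFactorial e +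
        8 * P.card * (1 * (∑ t ∈ P, W t + 1 + 1).ascFactorial e) := by gcongr
    _ = (∑ t ∈ P, W t + 9 * P.card) * (∑ t ∈ P, W t + 1 + 1).ascFactorial e := by ring
    _ ≤ (10 * (∑ t ∈ P, W t + 1)) * (∑ t ∈ P, W t + 1 + 1).ascFactorial e := by
        gcongr; omega
    _ = _ := by ring

lemma sum_ascFactorial_add_factorial_le_of_two_le (hP : P.Nonempty) (hW : ∀ t ∈ P, 1 ≤ W t)
    (e : ℕ) :
    (∑ t ∈ P, W t + 1) * (∑ t ∈ P, W t + 2) *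
        (∑ t ∈ P, (W t + 1).ascFactorial (e + 2) + 8 * P.card * (e + 2)!) ≤
      ((∑ t ∈ P, W t + 1) * (∑ t ∈ P, W t + 2) + 88) *
        (∑ t ∈ P, W t + 1).ascFactorial (e + 2) := by
  have h1 := sum_ascFactorial_add_two_le P W
    (fun t ht => Finset.single_le_sum (f := W) (fun _ _ => Nat.zero_le _) ht) e
  have h2 := sum_succ_mul_add_two_le P W hP hW
  rw [← Nat.one_ascFactorial, ascFactorial_add_two_left 1, ascFactorial_add_two_left (_ + 1)]
  generalize ∑ t ∈ P, W t = M at *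
  have h3 := ascFactorial_le_ascFactorial_left (by omega : 1 + 2 ≤ M + 3) e
  calc _ ≤ (M + 1) * (M + 2) * ((∑ t ∈ P, (W t + 1) * (W t + 2)) * (M + 3).ascFactorial e +
        8 * P.card * (1 * (1 + 1) * (M + 3).ascFactorial e)) := by gcongr
    _ = (M + 1) * (M + 2) * ((∑ t ∈ P, (W t + 1) * (W t + 2) + 16 * P.card) *
          (M + 3).ascFactorial e) := by ring
    _ ≤ (M + 1) * (M + 2) * (((M + 1) * (M + 2) + 88) * (M + 3).ascFactorial e) := by gcongr
    _ = _ := by ring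

section TwoLarge

variable {P W} {N : ℕ} {p q : κ}

lemma sum_pred_eq (hW : ∀ t ∈ P, 1 ≤ W t)
    (hN : ∑ t ∈ P, W t = N + P.card) : ∑ t ∈ P, (W t - 1) = N := by
  have := sum_eq_sum_pred_add_card P W hW
  omega

lemma le_of_two_large (hW : ∀ t ∈ P, 1 ≤ W t)
    (hN : ∑ t ∈ P, W t = N + P.card) (hp : p ∈ P) (hq : q ∈ P) (hpq : p ≠ q)
    (hWp : 2 ≤ W p) (hWq : 2 ≤ W q) {t : κ} (ht : t ∈ P) : W t ≤ N := by
  have h := sum_pred_eq hW hN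
  obtain ⟨s, hs, hst, hWs⟩ : ∃ s ∈ P, t ≠ s ∧ 2 ≤ W s := by
    by_cases htp : t = p
    · exact ⟨q, hq, htp ▸ hpq, hWq⟩
    · exact ⟨p, hp, htp, hWp⟩
  have h2 := Finset.add_le_sum (f := fun t => W t - 1) (fun _ _ => Nat.zero_le _) ht hs hst
  simp only [h] at h2
  omega

lemma sum_succ_mul_add_two_le_of_two_large (hW : ∀ t ∈ P, 1 ≤ W t)
    (hN : ∑ t ∈ P, W t = N + P.card) (hp : p ∈ P) (hq : q ∈ P) (hpq : p ≠ q)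
    (hWp : 2 ≤ W p) (hWq : 2 ≤ W q) :
    ∑ t ∈ P, (W t + 1) * (W t + 2) ≤ (N + 1) * (N + 2) + 6 * P.card := by
  rw [sum_succ_mul_add_two P W (fun t => W t - 1) fun t ht => by have := hW t ht; omega]
  have h := sum_pred_eq hW hN
  have h1 := sum_mul_self_le_sum_mul_sum (P.erase p) fun t => W t - 1
  have h2 : W q - 1 ≤ ∑ t ∈ P.erase p, (W t - 1) :=
    Finset.single_le_sum (f := fun t => W t - 1) (fun _ _ => Nat.zero_le _)
      (Finset.mem_erase.2 ⟨hpq.symm, hq⟩)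
  rw [← Finset.add_sum_erase P _ hp] at h ⊢
  rw [← Finset.add_sum_erase P _ hp]
  generalize ∑ t ∈ P.erase p, (W t - 1) = R at *
  generalize ∑ t ∈ P.erase p, (W t - 1) * (W t - 1) = Y at *
  obtain ⟨x, hx⟩ := Nat.exists_eq_add_of_le' hWp
  obtain ⟨R, rfl⟩ := Nat.exists_eq_add_of_le' (by omega : 1 ≤ R)
  have hx' : W p - 1 = x + 1 := by omega
  rw [hx'] at h ⊢
  subst h
  nlinarith [Nat.zero_le (x * R)]

/-- Adding `e + 1` to one of the entries of `W`, when two of them are at least `2`. -/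
lemma sum_ascFactorial_succ_le_of_two_large (hW : ∀ t ∈ P, 1 ≤ W t)
    (hN : ∑ t ∈ P, W t = N + P.card) (hp : p ∈ P) (hq : q ∈ P) (hpq : p ≠ q)
    (hWp : 2 ≤ W p) (hWq : 2 ≤ W q) (e : ℕ) :
    (N + 1) * ∑ t ∈ P, (W t + 1).ascFactorial (e + 1) ≤
      (N + 1 + 2 * P.card) * (N + 1).ascFactorial (e + 1) := by
  have h1 := sum_ascFactorial_succ_le P W
    (fun t ht => le_of_two_large hW hN hp hq hpq hWp hWq ht) e
  rw [hN] at h1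
  rw [ascFactorial_succ_left (N + 1)]
  calc _ ≤ (N + 1) * ((N + P.card + P.card) * (N + 2).ascFactorial e) := by gcongr
    _ ≤ (N + 1) * ((N + 1 + 2 * P.card) * (N + 2).ascFactorial e) :=
        Nat.mul_le_mul_left _ (Nat.mul_le_mul_right _ (by omega))
    _ = _ := by ring

/-- A sharper form of `sum_ascFactorial_succ_le_of_two_large` when the increment is at
least `2`. -/
lemma sum_ascFactorial_add_two_le_of_two_large (hW : ∀ t ∈ P, 1 ≤ W t)
    (hN : ∑ t ∈ P, W t = N + P.card) (hp : p ∈ P) (hq : q ∈ P) (hpq : p ≠ q)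
    (hWp : 2 ≤ W p) (hWq : 2 ≤ W q) (e : ℕ) :
    (N + 1) * (N + 2) * ∑ t ∈ P, (W t + 1).ascFactorial (e + 2) ≤
      ((N + 1) * (N + 2) + 6 * P.card) * (N + 1).ascFactorial (e + 2) := by
  have h1 := sum_ascFactorial_add_two_le P W
    (fun t ht => le_of_two_large hW hN hp hq hpq hWp hWq ht) e
  have h2 := sum_succ_mul_add_two_le_of_two_large hW hN hp hq hpq hWp hWq
  rw [ascFactorial_add_two_left (N + 1)]
  calc _ ≤ (N + 1) * (N + 2) *
        (((N + 1) * (N + 2) + 6 * P.card) * (N + 3).ascFactorial e) := by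
        gcongr
        exact h1.trans (Nat.mul_le_mul_right _ h2)
    _ = _ := by ring

end TwoLarge

end Arithmetic

lemma sum_le_sum_of_forall_exists_eq {κ μ : Type*} {s : Finset κ} {t : Finset μ} (f : μ → κ)
    (g : κ → ℕ) (h : ∀ x ∈ s, ∃ y ∈ t, f y = x) : ∑ x ∈ s, g x ≤ ∑ y ∈ t, g (f y) := by
  rcases s.eq_empty_or_nonempty with rfl | ⟨x₀, hx₀⟩
  · simp
  have : Nonempty μ := ⟨(h x₀ hx₀).choose⟩
  choose! k hk hf using h
  have hinj : Set.InjOn k s := fun x hx y hy hxy => by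
    rw [← hf x hx, ← hf y hy, hxy]
  calc ∑ x ∈ s, g x = ∑ x ∈ s, g (f (k x)) :=
        Finset.sum_congr rfl fun x hx => by rw [hf x hx]
    _ = ∑ y ∈ s.image k, g (f y) := (Finset.sum_image (f := fun y => g (f y)) hinj).symm
    _ ≤ ∑ y ∈ t, g (f y) :=
        Finset.sum_le_sum_of_subset (Finset.image_subset_iff.2 hk)

lemma one_add_mul_exp_le {C : ℝ} (hC : 0 ≤ C) (t : ℝ) {M M' : ℕ} (h : M + 1 ≤ M') :
    (1 + C / ((M + 1) * (M + 2))) * Real.exp (C * (t - 1 / ((M : ℝ) + 1))) ≤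
      Real.exp (C * (t - 1 / ((M' : ℝ) + 1))) := by
  have h1 : C / (((M : ℝ) + 1) * (M + 2)) = C * (1 / ((M : ℝ) + 1) - 1 / ((M : ℝ) + 2)) := by
    field_simp
    ring
  have h2 : 1 / ((M' : ℝ) + 1) ≤ 1 / ((M : ℝ) + 2) := by
    have : ((M : ℝ) + 1) ≤ M' := by exact_mod_cast h
    gcongr 1 / ?_
    linarith
  calc _ ≤ Real.exp (C * (1 / ((M : ℝ) + 1) - 1 / ((M : ℝ) + 2))) *
        Real.exp (C * (t - 1 / ((M : ℝ) + 1))) := by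
        gcongr
        rw [h1, add_comm]
        exact Real.add_one_le_exp _
    _ = Real.exp (C * (t - 1 / ((M : ℝ) + 2))) := by
        rw [← Real.exp_add]
        ring_nf
    _ ≤ _ := by gcongr

section Partitions

variable {ι : Type*} [DecidableEq ι]

lemma IsSetPartitionOn.eq_of_mem {S : Finset ι} {P : Finset (Finset ι)}
    (h : IsSetPartitionOn S P) {s t : Finset ι} (hs : s ∈ P) (ht : t ∈ P) {x : ι}
    (hxs : x ∈ s) (hxt : x ∈ t) : s = t :=
  (h.2 x ((h.1 s hs).1 hxs)).unique ⟨hs, hxs⟩ ⟨ht, hxt⟩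

lemma IsSetPartitionOn.sum_sum {S : Finset ι} {P : Finset (Finset ι)}
    (h : IsSetPartitionOn S P) (v : ι → ℕ) : ∑ t ∈ P, ∑ x ∈ t, v x = ∑ x ∈ S, v x := by
  have hS : S = P.biUnion id := by
    ext x
    simp only [Finset.mem_biUnion, id]
    exact ⟨fun hx => (h.2 x hx).exists, fun ⟨t, ht, hx⟩ => (h.1 t ht).1 hx⟩
  rw [hS, Finset.sum_biUnion]
  · rfl
  · intro s hs t ht hst
    exact Finset.disjoint_left.2 fun x hxs hxt => hst (h.eq_of_mem hs ht hxs hxt)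

lemma IsSetPartitionOn.nonempty {S : Finset ι} (hS : S.Nonempty) {P : Finset (Finset ι)}
    (h : IsSetPartitionOn S P) : P.Nonempty := by
  obtain ⟨y, hy⟩ := hS
  obtain ⟨t, ⟨ht, -⟩, -⟩ := h.2 y hy
  exact ⟨t, ht⟩

lemma IsSetPartitionOn.one_le_sum {S : Finset ι} {P : Finset (Finset ι)}
    (h : IsSetPartitionOn S P) {v : ι → ℕ} (hv : ∀ y, 1 ≤ v y) {t : Finset ι} (ht : t ∈ P) :
    1 ≤ ∑ y ∈ t, v y := by
  obtain ⟨y, hy⟩ := Finset.nonempty_iff_ne_empty.2 (h.1 t ht).2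
  exact (hv y).trans (Finset.single_le_sum (fun _ _ => Nat.zero_le _) hy)

lemma isSetPartitionOn_singleton {S : Finset ι} (hS : S.Nonempty) : IsSetPartitionOn S {S} := by
  refine ⟨fun s hs => ?_, fun x hx => ⟨S, ⟨Finset.mem_singleton_self S, hx⟩, fun t ht => ?_⟩⟩
  · rw [Finset.mem_singleton.1 hs]
    exact ⟨subset_rfl, hS.ne_empty⟩
  · exact Finset.mem_singleton.1 ht.1

lemma card_finsuppAntidiag_sub_two_le (P : Finset (Finset ι)) :
    (Finset.finsuppAntidiag P (P.card - 2)).card ≤ 4 ^ P.card := by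
  rw [Finset.card_finsuppAntidiag_nat_eq_choose]
  refine (Nat.choose_le_two_pow _ _).trans ?_
  rw [show 4 = 2 ^ 2 by norm_num, ← pow_mul]
  exact Nat.pow_le_pow_right (by norm_num) (by omega)

lemma abs_Emap_term_le (v : ι → ℕ) (P : Finset (Finset ι)) :
    |(-1 : ℝ) ^ (P.card - 1) * ((P.card - 2)! : ℝ) *
      ∑ d ∈ Finset.finsuppAntidiag P (P.card - 2),
        ∏ s ∈ P,
          (1 / ((d s)! : ℝ) * ((∑ x ∈ s, v x)! : ℝ) *
            zed ((∑ x ∈ s, v x : ℤ) - s.card - d s + 1))| ≤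
      ((8 ^ P.card * (P.card - 1)! * ∏ t ∈ P, (∑ x ∈ t, v x)! : ℕ) : ℝ) := by
  rw [abs_mul, abs_mul, abs_pow, abs_neg, abs_one, one_pow, one_mul, Nat.abs_cast]
  have hterm : ∀ d ∈ Finset.finsuppAntidiag P (P.card - 2),
      |∏ s ∈ P, (1 / ((d s)! : ℝ) * ((∑ x ∈ s, v x)! : ℝ) *
        zed ((∑ x ∈ s, v x : ℤ) - s.card - d s + 1))| ≤
        2 ^ P.card * ∏ s ∈ P, ((∑ x ∈ s, v x)! : ℝ) := by
    intro d _
    rw [Finset.abs_prod, ← Finset.prod_const, ← Finset.prod_mul_distrib]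
    refine Finset.prod_le_prod (fun _ _ => abs_nonneg _) fun s _ => ?_
    rw [abs_mul, abs_mul, abs_of_nonneg (by positivity : (0 : ℝ) ≤ 1 / ((d s)! : ℝ)),
      Nat.abs_cast, mul_comm]
    refine mul_le_mul (abs_zed_le_two _) ?_ (by positivity) (by norm_num)
    refine mul_le_of_le_one_left (by positivity) ?_
    rw [div_le_one (by positivity)]
    exact_mod_cast Nat.one_le_iff_ne_zero.2 (Nat.factorial_ne_zero _)
  have hcard : ((Finset.finsuppAntidiag P (P.card - 2)).card : ℝ) ≤ 4 ^ P.card := by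
    exact_mod_cast card_finsuppAntidiag_sub_two_le P
  have hfac : ((P.card - 2)! : ℝ) ≤ ((P.card - 1)! : ℝ) := by
    exact_mod_cast Nat.factorial_le (by omega)
  calc _ ≤ ((P.card - 1)! : ℝ) *
        (4 ^ P.card * (2 ^ P.card * ∏ s ∈ P, ((∑ x ∈ s, v x)! : ℝ))) := by
        refine mul_le_mul hfac ?_ (abs_nonneg _) (by positivity)
        refine (Finset.abs_sum_le_sum_abs _ _).trans ((Finset.sum_le_sum hterm).trans ?_)
        rw [Finset.sum_const, nsmul_eq_mul]
        exact mul_le_mul_of_nonneg_right hcard (by positivity)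
    _ = _ := by
        push_cast
        rw [show (8 : ℝ) = 4 * 2 by norm_num, mul_pow]
        ring

variable [Fintype ι]

/-- The finite set of all set partitions of `S`. -/
noncomputable def setPartitions (S : Finset ι) : Finset (Finset (Finset ι)) :=
  Finset.univ.filter fun P => IsSetPartitionOn S P

lemma mem_setPartitions {S : Finset ι} {P : Finset (Finset ι)} :
    P ∈ setPartitions S ↔ IsSetPartitionOn S P := by
  simp [setPartitions]

lemma IsSetPartitionOn.exists_of_insert {S : Finset ι} {x : ι} (hx : x ∉ S)
    {P : Finset (Finset ι)} (h : IsSetPartitionOn (insert x S) P) :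
    ∃ Q ∈ setPartitions S, P = insert {x} Q ∨
      ∃ t ∈ Q, P = insert (insert x t) (Q.erase t) := by
  obtain ⟨s, ⟨hs, hxs⟩, -⟩ := h.2 x (Finset.mem_insert_self x S)
  have hne : ∀ t ∈ P, t ≠ s → x ∉ t := fun t ht hts hxt => hts (h.eq_of_mem ht hs hxt hxs)
  have hsub : ∀ t ∈ P, t ≠ s → t ⊆ S := fun t ht hts y hy => by
    rcases Finset.mem_insert.1 ((h.1 t ht).1 hy) with rfl | hyS
    · exact absurd hy (hne t ht hts)
    · exact hyS
  by_cases hsx : s = {x}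
  · refine ⟨P.erase s, mem_setPartitions.2 ⟨fun t ht => ?_, fun y hy => ?_⟩, Or.inl ?_⟩
    · obtain ⟨hts, ht⟩ := Finset.mem_erase.1 ht
      exact ⟨hsub t ht hts, (h.1 t ht).2⟩
    · obtain ⟨t, ⟨ht, hyt⟩, hu⟩ := h.2 y (Finset.mem_insert_of_mem hy)
      refine ⟨t, ⟨Finset.mem_erase.2 ⟨?_, ht⟩, hyt⟩,
        fun u hu' => hu u ⟨Finset.mem_of_mem_erase hu'.1, hu'.2⟩⟩
      rintro rfl
      rw [hsx, Finset.mem_singleton] at hyt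
      exact hx (hyt ▸ hy)
    · rw [← hsx, Finset.insert_erase hs]
  · have hsub' : s.erase x ⊆ S := fun y hy => by
      obtain ⟨hyx, hy⟩ := Finset.mem_erase.1 hy
      exact (Finset.mem_insert.1 ((h.1 s hs).1 hy)).resolve_left hyx
    have hne' : (s.erase x).Nonempty := by
      rw [Finset.nonempty_iff_ne_empty, Ne, Finset.erase_eq_empty_iff]
      exact fun h' => h'.elim (h.1 s hs).2 hsx
    have hmem : s.erase x ∉ P.erase s := fun hmem => by
      obtain ⟨y, hy⟩ := hne'
      obtain ⟨h1, h2⟩ := Finset.mem_erase.1 hmem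
      exact h1 (h.eq_of_mem h2 hs hy (Finset.mem_of_mem_erase hy))
    refine ⟨insert (s.erase x) (P.erase s),
      mem_setPartitions.2 ⟨fun t ht => ?_, fun y hy => ?_⟩,
      Or.inr ⟨s.erase x, Finset.mem_insert_self _ _, ?_⟩⟩
    · rcases Finset.mem_insert.1 ht with rfl | ht
      · exact ⟨hsub', hne'.ne_empty⟩
      · obtain ⟨hts, ht⟩ := Finset.mem_erase.1 ht
        exact ⟨hsub t ht hts, (h.1 t ht).2⟩
    · have hyx : y ≠ x := fun h' => hx (h' ▸ hy)
      obtain ⟨t, ⟨ht, hyt⟩, hu⟩ := h.2 y (Finset.mem_insert_of_mem hy)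
      by_cases hts : t = s
      · subst hts
        refine ⟨t.erase x, ⟨Finset.mem_insert_self _ _, Finset.mem_erase.2 ⟨hyx, hyt⟩⟩,
          fun u ⟨hu1, hu2⟩ => ?_⟩
        rcases Finset.mem_insert.1 hu1 with rfl | hu1
        · rfl
        · exact absurd (hu u ⟨Finset.mem_of_mem_erase hu1, hu2⟩) (Finset.ne_of_mem_erase hu1)
      · refine ⟨t, ⟨Finset.mem_insert_of_mem (Finset.mem_erase.2 ⟨hts, ht⟩), hyt⟩,
          fun u ⟨hu1, hu2⟩ => ?_⟩
        rcases Finset.mem_insert.1 hu1 with rfl | hu1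
        · exact absurd (h.eq_of_mem ht hs hyt (Finset.mem_of_mem_erase hu2)) hts
        · exact hu u ⟨Finset.mem_of_mem_erase hu1, hu2⟩
    · rw [Finset.insert_erase hxs, Finset.erase_insert hmem, Finset.insert_erase hs]

lemma sum_setPartitions_insert_le {S : Finset ι} {x : ι} (hx : x ∉ S)
    (g : Finset (Finset ι) → ℕ) :
    ∑ P ∈ setPartitions (insert x S), g P ≤
      ∑ P ∈ setPartitions S,
        (g (insert {x} P) + ∑ t ∈ P, g (insert (insert x t) (P.erase t))) := by
  have key := sum_le_sum_of_forall_exists_eq (s := setPartitions (insert x S))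
    (t := (setPartitions S).sigma fun P => Finset.insertNone P)
    (fun y => y.2.elim (insert {x} y.1) fun t => insert (insert x t) (y.1.erase t)) g ?_
  · refine key.trans_eq ?_
    rw [Finset.sum_sigma]
    refine Finset.sum_congr rfl fun P _ => ?_
    rw [Finset.sum_insertNone]
    rfl
  · intro P hP
    obtain ⟨Q, hQ, h | ⟨t, ht, h⟩⟩ := (mem_setPartitions.1 hP).exists_of_insert hx
    · exact ⟨⟨Q, none⟩, by simp [hQ], h.symm⟩
    · exact ⟨⟨Q, some t⟩, by simp [hQ, ht], h.symm⟩

/-- A weighted count of the set partitions of `S` that dominates `innerSingle S v`. -/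
noncomputable def partitionWeight (S : Finset ι) (v : ι → ℕ) : ℕ :=
  ∑ P ∈ setPartitions S, 8 ^ P.card * (P.card - 1)! * ∏ t ∈ P, (∑ x ∈ t, v x)!

lemma partitionWeight_insert_le {S : Finset ι} (hS : S.Nonempty) {x : ι} (hx : x ∉ S)
    (v : ι → ℕ) :
    partitionWeight (insert x S) v ≤
      ∑ P ∈ setPartitions S, 8 ^ P.card * (P.card - 1)! * (∏ t ∈ P, (∑ y ∈ t, v y)!) *
        (∑ t ∈ P, (∑ y ∈ t, v y + 1).ascFactorial (v x) + 8 * P.card * (v x)!) := by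
  refine (sum_setPartitions_insert_le hx _).trans (Finset.sum_le_sum fun P hP => ?_)
  rw [mem_setPartitions] at hP
  have hxP : ∀ t ∈ P, x ∉ t := fun t ht hxt => hx ((hP.1 t ht).1 hxt)
  obtain ⟨r, hr⟩ : ∃ r, P.card = r + 1 := by
    obtain ⟨y, hy⟩ := hS
    obtain ⟨t, ⟨ht, -⟩, -⟩ := hP.2 y hy
    exact Nat.exists_eq_add_of_le' (Finset.card_pos.2 ⟨t, ht⟩)
  rw [mul_add, add_comm]
  refine _root_.add_le_add ?_ ?_
  · rw [Finset.mul_sum]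
    refine (Finset.sum_congr rfl fun t ht => ?_).le
    have h1 : insert x t ∉ P.erase t := fun h =>
      hxP _ (Finset.mem_of_mem_erase h) (Finset.mem_insert_self _ _)
    rw [Finset.card_insert_of_notMem h1, Finset.card_erase_of_mem ht, Finset.prod_insert h1,
      ← Finset.mul_prod_erase P _ ht, Finset.sum_insert (hxP t ht), hr,
      add_comm (v x), ← Nat.factorial_mul_ascFactorial]
    simp only [Nat.add_sub_cancel]
    ring
  · have h1 : {x} ∉ P := fun h => hxP _ h (Finset.mem_singleton_self x)
    rw [Finset.card_insert_of_notMem h1, Finset.prod_insert h1, Finset.sum_singleton, hr]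
    simp only [Nat.add_sub_cancel, Nat.factorial_succ]
    apply le_of_eq
    ring

lemma partitionWeight_insert_le_of_one_le {S : Finset ι} (hS : S.Nonempty) {x : ι}
    (hx : x ∉ S) {v : ι → ℕ} (hv : ∀ y, 1 ≤ v y) :
    partitionWeight (insert x S) v ≤
      10 * (∑ y ∈ S, v y + 1).ascFactorial (v x) * partitionWeight S v := by
  refine (partitionWeight_insert_le hS hx v).trans ?_
  rw [partitionWeight, Finset.mul_sum]
  refine Finset.sum_le_sum fun P hP => ?_
  rw [mem_setPartitions] at hP
  obtain ⟨e, he⟩ := Nat.exists_eq_add_of_le' (hv x)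
  have := sum_ascFactorial_add_factorial_le P (fun t => ∑ y ∈ t, v y)
    (fun t ht => hP.one_le_sum hv ht) e
  rw [hP.sum_sum] at this
  rw [mul_comm, he]
  exact Nat.mul_le_mul_right _ this

lemma partitionWeight_insert_le_of_two_le {S : Finset ι} (hS : S.Nonempty) {x : ι}
    (hx : x ∉ S) {v : ι → ℕ} (hv : ∀ y, 1 ≤ v y) (hvx : 2 ≤ v x) :
    (∑ y ∈ S, v y + 1) * (∑ y ∈ S, v y + 2) * partitionWeight (insert x S) v ≤
      ((∑ y ∈ S, v y + 1) * (∑ y ∈ S, v y + 2) + 88) *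
        (∑ y ∈ S, v y + 1).ascFactorial (v x) * partitionWeight S v := by
  refine (Nat.mul_le_mul_left _ (partitionWeight_insert_le hS hx v)).trans ?_
  rw [partitionWeight, Finset.mul_sum, Finset.mul_sum]
  refine Finset.sum_le_sum fun P hP => ?_
  rw [mem_setPartitions] at hP
  obtain ⟨e, he⟩ := Nat.exists_eq_add_of_le' hvx
  have := sum_ascFactorial_add_factorial_le_of_two_le P (fun t => ∑ y ∈ t, v y)
    (hP.nonempty hS) (fun t ht => hP.one_le_sum hv ht) e
  rw [hP.sum_sum] at this
  rw [mul_left_comm, mul_comm _ (8 ^ _ * _ * _), he]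
  exact Nat.mul_le_mul_left _ this

lemma setPartitions_singleton (x : ι) : setPartitions {x} = {{{x}}} := by
  ext P
  rw [mem_setPartitions, Finset.mem_singleton]
  constructor
  · intro h
    obtain ⟨t, ⟨ht, hxt⟩, -⟩ := h.2 x (Finset.mem_singleton_self x)
    refine Finset.eq_singleton_iff_nonempty_unique_mem.2 ⟨⟨t, ht⟩, fun s hs => ?_⟩
    exact (Finset.subset_singleton_iff.1 (h.1 s hs).1).resolve_left (h.1 s hs).2
  · rintro rfl
    simp [IsSetPartitionOn, ExistsUnique]

lemma partitionWeight_singleton (x : ι) (v : ι → ℕ) : partitionWeight {x} v = 8 * (v x)! := by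
  simp [partitionWeight, setPartitions_singleton]

lemma abs_innerSingle_le_partitionWeight {S : Finset ι} (hS : S.Nonempty) (v : ι → ℕ) :
    |innerSingle S v| ≤ partitionWeight S v := by
  rw [innerSingle, partitionWeight, ← Finset.sum_filter_add_sum_filter_not (setPartitions S)
    (fun P => 2 ≤ P.card), Nat.cast_add, add_comm ((∑ P ∈ _, _ : ℕ) : ℝ)]
  refine (abs_add_le _ _).trans (_root_.add_le_add ?_ ?_)
  · have hmem : {S} ∈ (setPartitions S).filter (fun P => ¬ 2 ≤ P.card) := by
      simp [mem_setPartitions, isSetPartitionOn_singleton hS]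
    have h1 := Finset.single_le_sum
      (f := fun P : Finset (Finset ι) =>
        8 ^ P.card * (P.card - 1)! * ∏ t ∈ P, (∑ x ∈ t, v x)!)
      (fun _ _ => Nat.zero_le _) hmem
    refine le_trans ?_ (Nat.cast_le.2 h1)
    rw [abs_mul, Nat.abs_cast]
    simp only [Finset.card_singleton, Finset.prod_singleton]
    push_cast
    have := abs_zed_le_two ((∑ x ∈ S, v x : ℤ) - S.card + 2)
    have h2 : (0 : ℝ) ≤ ((∑ x ∈ S, v x)! : ℝ) := by positivity
    simp only [Nat.factorial_zero]
    push_cast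
    nlinarith
  · rw [Emap, setPartitions, Finset.filter_filter, Nat.cast_sum]
    refine (Finset.abs_sum_le_sum_abs _ _).trans (Finset.sum_le_sum fun P _ => ?_)
    exact abs_Emap_term_le v P

lemma partitionWeight_le_ten_pow {S : Finset ι} (hS : S.Nonempty) {v : ι → ℕ}
    (hv : ∀ y, 1 ≤ v y) : partitionWeight S v ≤ 10 ^ S.card * (∑ x ∈ S, v x)! := by
  induction hS using Finset.Nonempty.cons_induction with
  | singleton x =>
    rw [partitionWeight_singleton, Finset.card_singleton, Finset.sum_singleton]
    gcongr
    norm_num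
  | cons x S hx hS ih =>
    rw [Finset.cons_eq_insert]
    refine (partitionWeight_insert_le_of_one_le hS hx hv).trans ?_
    rw [Finset.card_insert_of_notMem hx, Finset.sum_insert hx, add_comm (v x),
      ← Nat.factorial_mul_ascFactorial]
    calc _ ≤ 10 * (∑ y ∈ S, v y + 1).ascFactorial (v x) * (10 ^ S.card * (∑ x ∈ S, v x)!) := by
          gcongr
      _ = _ := by ring

lemma partitionWeight_union_le {S X : Finset ι} (hS : S.Nonempty) (hX : Disjoint S X)
    {v : ι → ℕ} (hv : ∀ y, 1 ≤ v y) (hvX : ∀ y ∈ X, 2 ≤ v y) :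
    (partitionWeight (S ∪ X) v : ℝ) ≤
      10 ^ S.card * Real.exp (88 * (1 / 2 - 1 / (((∑ x ∈ S ∪ X, v x : ℕ) : ℝ) + 1))) *
        (∑ x ∈ S ∪ X, v x)! := by
  induction X using Finset.induction_on with
  | empty =>
    rw [Finset.union_empty]
    have h1 : (1 : ℝ) ≤ ((∑ x ∈ S, v x : ℕ) : ℝ) := by
      obtain ⟨y, hy⟩ := hS
      exact_mod_cast (hv y).trans (Finset.single_le_sum (fun _ _ => Nat.zero_le _) hy)
    have h2 : 1 ≤ Real.exp (88 * (1 / 2 - 1 / (((∑ x ∈ S, v x : ℕ) : ℝ) + 1))) := by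
      refine Real.one_le_exp (mul_nonneg (by norm_num) (sub_nonneg.2 ?_))
      gcongr
      linarith
    have h3 : (partitionWeight S v : ℝ) ≤ 10 ^ S.card * (∑ x ∈ S, v x)! := by
      exact_mod_cast partitionWeight_le_ten_pow hS hv
    refine h3.trans ?_
    gcongr
    exact le_mul_of_one_le_right (by positivity) h2
  | insert x X hx ih =>
    have hdis := Finset.disjoint_insert_right.1 hX
    have hxu : x ∉ S ∪ X := by simp [hdis.1, hx]
    have ih := ih hdis.2 fun y hy => hvX y (Finset.mem_insert_of_mem hy)
    have hvx := hvX x (Finset.mem_insert_self x X)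
    rw [Finset.union_insert, Finset.sum_insert hxu, add_comm (v x),
      ← Nat.factorial_mul_ascFactorial]
    have h1 := partitionWeight_insert_le_of_two_le (hS.mono Finset.subset_union_left) hxu hv hvx
    generalize ∑ y ∈ S ∪ X, v y = M at *
    have h2 : (partitionWeight (insert x (S ∪ X)) v : ℝ) ≤
        (1 + 88 / (((M : ℝ) + 1) * (M + 2))) *
          ((M + 1).ascFactorial (v x) * partitionWeight (S ∪ X) v) := by
      have h1' : (((M : ℝ) + 1) * (M + 2)) * partitionWeight (insert x (S ∪ X)) v ≤
          (((M : ℝ) + 1) * (M + 2) + 88) * (M + 1).ascFactorial (v x) *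
            partitionWeight (S ∪ X) v := by exact_mod_cast h1
      rw [show (1 + 88 / (((M : ℝ) + 1) * (M + 2))) =
        (((M : ℝ) + 1) * (M + 2) + 88) / (((M : ℝ) + 1) * (M + 2)) by field_simp,
        div_mul_eq_mul_div, le_div_iff₀ (by positivity)]
      linarith
    have h3 := one_add_mul_exp_le (C := 88) (by norm_num) (1 / 2) (by omega : M + 1 ≤ M + v x)
    calc _ ≤ _ := h2
      _ ≤ (1 + 88 / (((M : ℝ) + 1) * (M + 2))) * ((M + 1).ascFactorial (v x) *
          (10 ^ S.card * Real.exp (88 * (1 / 2 - 1 / ((M : ℝ) + 1))) * M !)) := by gcongr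
      _ = 10 ^ S.card * ((1 + 88 / (((M : ℝ) + 1) * (M + 2))) *
          Real.exp (88 * (1 / 2 - 1 / ((M : ℝ) + 1)))) *
            (M ! * (M + 1).ascFactorial (v x)) := by ring
      _ ≤ _ := by
        push_cast at h3 ⊢
        gcongr

lemma exp_le_two_pow (k : ℕ) : Real.exp (2 * k) ≤ 2 ^ (3 * k) := by
  rw [mul_comm, Real.exp_nat_mul, pow_mul]
  gcongr
  rw [show (2 : ℝ) = (2 : ℕ) * 1 by norm_num, Real.exp_nat_mul]
  have := Real.exp_one_lt_d9
  calc Real.exp 1 ^ 2 ≤ 2.7182818286 ^ 2 := by gcongr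
    _ ≤ _ := by norm_num

lemma exp_forty_four_le : Real.exp 44 ≤ 2 ^ 64 := by
  rw [show (44 : ℝ) = (44 : ℕ) * 1 by norm_num, Real.exp_nat_mul]
  have := Real.exp_one_lt_d9
  calc Real.exp 1 ^ 44 ≤ 2.7182818286 ^ 44 := by gcongr
    _ ≤ _ := by norm_num

/-- The single inner product is at most `|v_S|!` up to a factor which is exponential in the
number of elements of `S` where `v` may equal `1`. -/
lemma abs_innerSingle_le {S A : Finset ι} (hSA : (S ∩ A).Nonempty) {v : ι → ℕ}
    (hv : ∀ y, 1 ≤ v y) (hvA : ∀ y ∉ A, 2 ≤ v y) :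
    |innerSingle S v| ≤ 2 ^ (4 * (S ∩ A).card + 64) * (∑ x ∈ S, v x)! := by
  have hS : S ∩ A ∪ S \ A = S := by
    rw [Finset.union_comm, Finset.sdiff_union_inter]
  have h1 := partitionWeight_union_le hSA (Finset.disjoint_sdiff_inter S A).symm hv
    fun y hy => hvA y (Finset.mem_sdiff.1 hy).2
  rw [hS] at h1
  refine (abs_innerSingle_le_partitionWeight (hSA.mono Finset.inter_subset_left) v).trans
    (h1.trans ?_)
  gcongr
  rw [pow_add, pow_mul]
  gcongr
  · norm_num
  · refine le_trans (Real.exp_le_exp.2 ?_) exp_forty_four_le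
    have : 0 ≤ 1 / (((∑ x ∈ S, v x : ℕ) : ℝ) + 1) := by positivity
    linarith

end Partitions

section Assignments

lemma factorial_succ_mul_factorial_succ_le (x y : ℕ) :
    (x + 1)! * (y + 1)! ≤ (x + y + 1)! := by
  induction y with
  | zero => simp
  | succ y ih =>
    rw [Nat.factorial_succ (y + 1), show x + (y + 1) + 1 = (x + y + 1) + 1 by ring,
      Nat.factorial_succ (x + y + 1)]
    calc (x + 1)! * ((y + 1 + 1) * (y + 1)!) = (y + 1 + 1) * ((x + 1)! * (y + 1)!) := by ring
      _ ≤ (x + y + 1 + 1) * (x + y + 1)! := by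
        gcongr
        omega

lemma factorial_add_two_mul_factorial_add_two_le (x y : ℕ) :
    (x + 2)! * (y + 2)! ≤ 2 * (x + y + 2)! := by
  induction y with
  | zero => simp [mul_comm]
  | succ y ih =>
    rw [show y + 1 + 2 = (y + 2) + 1 by ring, Nat.factorial_succ (y + 2),
      show x + (y + 1) + 2 = (x + y + 2) + 1 by ring, Nat.factorial_succ (x + y + 2)]
    calc (x + 2)! * ((y + 2 + 1) * (y + 2)!) = (y + 2 + 1) * ((x + 2)! * (y + 2)!) := by ring
      _ ≤ (x + y + 2 + 1) * (2 * (x + y + 2)!) := by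
        gcongr
        omega
      _ = _ := by ring

variable {ι : Type*} {v : ι → ℕ} {Q X : Finset ι}

lemma prod_factorial_le (hv : ∀ y, 1 ≤ v y) :
    ∏ c ∈ Q, (v c)! ≤ (∑ c ∈ Q, (v c - 1) + 1)! := by
  induction Q using Finset.cons_induction with
  | empty => simp
  | cons c Q hc ih =>
    rw [Finset.prod_cons, Finset.sum_cons]
    obtain ⟨x, hx⟩ := Nat.exists_eq_add_of_le' (hv c)
    rw [hx, Nat.add_sub_cancel]
    exact (Nat.mul_le_mul_left _ ih).trans (factorial_succ_mul_factorial_succ_le _ _)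

/-- The values of `v` on `Q` are positive, and two of them are at least `2`. -/
structure HasTwoLarge (v : ι → ℕ) (Q : Finset ι) : Prop where
  one_le : ∀ y, 1 ≤ v y
  exists_ne : ∃ p ∈ Q, ∃ q ∈ Q, p ≠ q ∧ 2 ≤ v p ∧ 2 ≤ v q

lemma HasTwoLarge.two_add_card_le (hv : HasTwoLarge v Q) : 2 + Q.card ≤ ∑ c ∈ Q, v c := by
  obtain ⟨hv1, p, hp, q, hq, hpq, hvp, hvq⟩ := hv
  have h1 := sum_eq_sum_pred_add_card Q v fun c _ => hv1 c
  have h2 := Finset.add_le_sum (f := fun t => v t - 1) (fun _ _ => Nat.zero_le _) hp hq hpq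
  omega

variable [DecidableEq ι]

lemma prod_factorial_le_of_two_large {N : ℕ} (hv : ∀ y, 1 ≤ v y)
    (hN : ∑ c ∈ Q, v c = N + Q.card) {p q : ι} (hp : p ∈ Q) (hq : q ∈ Q) (hpq : p ≠ q)
    (hvp : 2 ≤ v p) (hvq : 2 ≤ v q) : ∏ c ∈ Q, (v c)! ≤ 2 * N ! := by
  have h := sum_pred_eq (fun c _ => hv c) hN
  have h2 : v q - 1 ≤ ∑ t ∈ Q.erase p, (v t - 1) :=
    Finset.single_le_sum (f := fun t => v t - 1) (fun _ _ => Nat.zero_le _)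
      (Finset.mem_erase.2 ⟨hpq.symm, hq⟩)
  have h3 := prod_factorial_le (Q := Q.erase p) hv
  rw [← Finset.add_sum_erase Q _ hp] at h
  rw [← Finset.mul_prod_erase Q _ hp]
  generalize ∑ t ∈ Q.erase p, (v t - 1) = R at *
  obtain ⟨x, hx⟩ := Nat.exists_eq_add_of_le' hvp
  obtain ⟨R, rfl⟩ := Nat.exists_eq_add_of_le' (by omega : 1 ≤ R)
  have hNx : N = x + R + 2 := by omega
  rw [hx, hNx]
  exact (Nat.mul_le_mul_left _ h3).trans (factorial_add_two_mul_factorial_add_two_le x R)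

/-- The total value at `c` after each `x ∈ X` has been attached to `q x`. -/
def assignedValue (v : ι → ℕ) (X : Finset ι) (q : ι → ι) (c : ι) : ℕ :=
  v c + ∑ x ∈ X with q x = c, v x

lemma sum_assignedValue {q : ι → ι} (hq : ∀ x ∈ X, q x ∈ Q) :
    ∑ c ∈ Q, assignedValue v X q c = ∑ c ∈ Q, v c + ∑ x ∈ X, v x := by
  simp only [assignedValue, Finset.sum_add_distrib]
  rw [Finset.sum_fiberwise_of_maps_to hq]

lemma le_assignedValue (v : ι → ℕ) (X : Finset ι) (q : ι → ι) (c : ι) :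
    v c ≤ assignedValue v X q c :=
  Nat.le_add_right _ _

lemma assignedValue_insert_update {x : ι} (hx : x ∉ X) (q : ι → ι) (c c' : ι) :
    assignedValue v (insert x X) (Function.update q x c) c' =
      assignedValue v X q c' + if c' = c then v x else 0 := by
  have h : ∑ y ∈ X with Function.update q x c y = c', v y = ∑ y ∈ X with q y = c', v y := by
    refine Finset.sum_congr (Finset.filter_congr fun y hy => ?_) fun _ _ => rfl
    rw [Function.update_of_ne]
    rintro rfl
    exact hx hy
  unfold assignedValue
  rw [Finset.filter_insert]
  by_cases hc : c' = c
  · subst hc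
    rw [if_pos (Function.update_self ..), Finset.sum_insert (by simp [hx]), h, if_pos rfl]
    ring
  · rw [if_neg (by rw [Function.update_self]; exact Ne.symm hc), h, if_neg hc, add_zero]

lemma prod_factorial_assignedValue_insert {x : ι} (hx : x ∉ X) (q : ι → ι) {c : ι}
    (hc : c ∈ Q) :
    ∏ c' ∈ Q, (assignedValue v (insert x X) (Function.update q x c) c')! =
      (∏ c' ∈ Q, (assignedValue v X q c')!) *
        (assignedValue v X q c + 1).ascFactorial (v x) := by
  have h : ∀ c' ∈ Q, (assignedValue v (insert x X) (Function.update q x c) c')! =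
      (assignedValue v X q c')! *
        if c' = c then (assignedValue v X q c' + 1).ascFactorial (v x) else 1 := by
    intro c' _
    rw [assignedValue_insert_update hx]
    split_ifs
    · rw [Nat.factorial_mul_ascFactorial]
    · simp
  rw [Finset.prod_congr rfl h, Finset.prod_mul_distrib, Finset.prod_ite_eq' Q c, if_pos hc]

variable [Fintype ι]

/-- The maps `q : ι → ι` with `q x ∈ Q` for `x ∈ X` and `q x = x` otherwise. -/
def assignments (Q X : Finset ι) : Finset (ι → ι) :=
  Fintype.piFinset fun x => if x ∈ X then Q else {x}

lemma mem_assignments {q : ι → ι} :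
    q ∈ assignments Q X ↔ (∀ x ∈ X, q x ∈ Q) ∧ ∀ x ∉ X, q x = x := by
  rw [assignments, Fintype.mem_piFinset]
  constructor
  · intro h
    exact ⟨fun x hx => by simpa [hx] using h x, fun x hx => by simpa [hx] using h x⟩
  · rintro ⟨h1, h2⟩ x
    by_cases hx : x ∈ X
    · simpa [hx] using h1 x hx
    · simpa [hx] using h2 x hx

/-- The sum over all assignments of the product of the factorials of the resulting values. -/
def assignmentWeight (v : ι → ℕ) (Q X : Finset ι) : ℕ :=
  ∑ q ∈ assignments Q X, ∏ c ∈ Q, (assignedValue v X q c)!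

lemma assignmentWeight_empty : assignmentWeight v Q ∅ = ∏ c ∈ Q, (v c)! := by
  have : assignments Q ∅ = {id} := by
    ext q
    simp [mem_assignments, funext_iff]
  simp [assignmentWeight, this, assignedValue]

lemma assignmentWeight_insert_le {x : ι} (hx : x ∉ X) :
    assignmentWeight v Q (insert x X) ≤
      ∑ q ∈ assignments Q X, (∏ c ∈ Q, (assignedValue v X q c)!) *
        ∑ c ∈ Q, (assignedValue v X q c + 1).ascFactorial (v x) := by
  refine (sum_le_sum_of_forall_exists_eq (t := assignments Q X ×ˢ Q)
    (fun y => Function.update y.1 x y.2) _ fun q hq => ?_).trans_eq ?_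
  · rw [mem_assignments] at hq
    refine ⟨(Function.update q x x, q x), Finset.mem_product.2
      ⟨mem_assignments.2 ⟨fun y hy => ?_, fun y hy => ?_⟩,
        hq.1 x (Finset.mem_insert_self _ _)⟩, by simp⟩
    all_goals dsimp only
    · have hyx : y ≠ x := fun h => hx (h ▸ hy)
      rw [Function.update_of_ne hyx]
      exact hq.1 y (Finset.mem_insert_of_mem hy)
    · by_cases hyx : y = x
      · subst hyx
        simp
      · rw [Function.update_of_ne hyx]
        exact hq.2 y (by simp [hyx, hy])
  · rw [Finset.sum_product]
    refine Finset.sum_congr rfl fun q _ => ?_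
    rw [Finset.mul_sum]
    exact Finset.sum_congr rfl fun c hc => prod_factorial_assignedValue_insert hx q hc

lemma assignmentWeight_insert_le_of_one_le (hv : HasTwoLarge v Q) {N : ℕ}
    (hN : ∑ c ∈ Q, v c + ∑ x ∈ X, v x = N + Q.card) {x : ι} (hx : x ∉ X) :
    (N + 1) * assignmentWeight v Q (insert x X) ≤
      (N + 1 + 2 * Q.card) * (N + 1).ascFactorial (v x) * assignmentWeight v Q X := by
  obtain ⟨hv1, p, hp, q, hq, hpq, hvp, hvq⟩ := hv
  refine (Nat.mul_le_mul_left _ (assignmentWeight_insert_le hx)).trans ?_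
  rw [assignmentWeight, Finset.mul_sum, Finset.mul_sum]
  refine Finset.sum_le_sum fun f hf => ?_
  obtain ⟨e, he⟩ := Nat.exists_eq_add_of_le' (hv1 x)
  have hle := le_assignedValue v X f
  have := sum_ascFactorial_succ_le_of_two_large (fun c _ => (hv1 c).trans (hle c))
    ((sum_assignedValue (mem_assignments.1 hf).1).trans hN) hp hq hpq
    (hvp.trans (hle p)) (hvq.trans (hle q)) e
  rw [mul_left_comm, mul_comm _ (∏ c ∈ Q, _), he]
  exact Nat.mul_le_mul_left _ this

lemma assignmentWeight_insert_le_of_two_le (hv : HasTwoLarge v Q) {N : ℕ}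
    (hN : ∑ c ∈ Q, v c + ∑ x ∈ X, v x = N + Q.card) {x : ι} (hx : x ∉ X) (hvx : 2 ≤ v x) :
    (N + 1) * (N + 2) * assignmentWeight v Q (insert x X) ≤
      ((N + 1) * (N + 2) + 6 * Q.card) * (N + 1).ascFactorial (v x) *
        assignmentWeight v Q X := by
  obtain ⟨hv1, p, hp, q, hq, hpq, hvp, hvq⟩ := hv
  refine (Nat.mul_le_mul_left _ (assignmentWeight_insert_le hx)).trans ?_
  rw [assignmentWeight, Finset.mul_sum, Finset.mul_sum]
  refine Finset.sum_le_sum fun f hf => ?_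
  obtain ⟨e, he⟩ := Nat.exists_eq_add_of_le' hvx
  have hle := le_assignedValue v X f
  have := sum_ascFactorial_add_two_le_of_two_large (fun c _ => (hv1 c).trans (hle c))
    ((sum_assignedValue (mem_assignments.1 hf).1).trans hN) hp hq hpq
    (hvp.trans (hle p)) (hvq.trans (hle q)) e
  rw [mul_left_comm, mul_comm _ (∏ c ∈ Q, _), he]
  exact Nat.mul_le_mul_left _ this

lemma assignmentWeight_le_choose (hv : HasTwoLarge v Q) {N : ℕ}
    (hN : ∑ c ∈ Q, v c + ∑ x ∈ X, v x = N + Q.card) :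
    assignmentWeight v Q X ≤ 2 * (2 * Q.card + X.card).choose X.card * N ! := by
  induction X using Finset.induction_on generalizing N with
  | empty =>
    obtain ⟨hv1, p, hp, q, hq, hpq, hvp, hvq⟩ := hv
    rw [assignmentWeight_empty]
    simpa using prod_factorial_le_of_two_large hv1 (by simpa using hN) hp hq hpq hvp hvq
  | insert x X hx ih =>
    obtain ⟨M, hM⟩ := Nat.exists_eq_add_of_le'
      (hv.two_add_card_le.trans (Nat.le_add_right _ (∑ x ∈ X, v x)))
    replace hM : ∑ c ∈ Q, v c + ∑ x ∈ X, v x = (M + 2) + Q.card := by omega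
    rw [Finset.sum_insert hx] at hN
    have hNM : N = M + 2 + v x := by omega
    have h1 := assignmentWeight_insert_le_of_one_le hv hM hx
    have h2 := ih hM
    have hXM : X.card ≤ M + 2 := by
      have h3 := hv.two_add_card_le
      have h4 : X.card ≤ ∑ x ∈ X, v x := by
        simpa using Finset.sum_le_sum fun x (_ : x ∈ X) => hv.one_le x
      omega
    rw [hNM, ← Nat.factorial_mul_ascFactorial, Finset.card_insert_of_notMem hx]
    generalize M + 2 = N₀ at *
    have h3 := Nat.add_one_mul_choose_eq (2 * Q.card + X.card) X.card
    have h4 : (N₀ + 1 + 2 * Q.card) * (X.card + 1) ≤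
        (N₀ + 1) * (2 * Q.card + X.card + 1) := by
      nlinarith [Nat.mul_le_mul_left (2 * Q.card) hXM]
    refine Nat.le_of_mul_le_mul_left (?_ : (N₀ + 1) * (X.card + 1) * _ ≤ _) (by positivity)
    calc (N₀ + 1) * (X.card + 1) * assignmentWeight v Q (insert x X)
        = (X.card + 1) * ((N₀ + 1) * assignmentWeight v Q (insert x X)) := by ring
      _ ≤ (X.card + 1) * ((N₀ + 1 + 2 * Q.card) * (N₀ + 1).ascFactorial (v x) *
          (2 * (2 * Q.card + X.card).choose X.card * N₀ !)) :=
        Nat.mul_le_mul_left _ (h1.trans (Nat.mul_le_mul_left _ h2))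
      _ = ((N₀ + 1 + 2 * Q.card) * (X.card + 1)) *
          (2 * (2 * Q.card + X.card).choose X.card *
            (N₀ ! * (N₀ + 1).ascFactorial (v x))) := by ring
      _ ≤ ((N₀ + 1) * (2 * Q.card + X.card + 1)) *
          (2 * (2 * Q.card + X.card).choose X.card *
            (N₀ ! * (N₀ + 1).ascFactorial (v x))) := by gcongr
      _ = 2 * (N₀ + 1) * ((2 * Q.card + X.card + 1) * (2 * Q.card + X.card).choose X.card) *
            (N₀ ! * (N₀ + 1).ascFactorial (v x)) := by ring
      _ = _ := by
        rw [h3, ← add_assoc]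
        ring

lemma assignmentWeight_union_le {Y : Finset ι} (hXY : Disjoint X Y) (hv : HasTwoLarge v Q)
    (hvY : ∀ y ∈ Y, 2 ≤ v y) {N : ℕ}
    (hN : ∑ c ∈ Q, v c + ∑ x ∈ X ∪ Y, v x = N + Q.card) :
    (assignmentWeight v Q (X ∪ Y) : ℝ) ≤
      2 * (2 * Q.card + X.card).choose X.card *
        Real.exp (6 * Q.card * (1 / 3 - 1 / ((N : ℝ) + 1))) * N ! := by
  induction Y using Finset.induction_on generalizing N with
  | empty =>
    rw [Finset.union_empty] at hN ⊢
    have hN2 : (2 : ℝ) ≤ N := by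
      have := hv.two_add_card_le
      exact_mod_cast (by omega : 2 ≤ N)
    have h2 : 1 ≤ Real.exp (6 * Q.card * (1 / 3 - 1 / ((N : ℝ) + 1))) := by
      refine Real.one_le_exp (mul_nonneg (by positivity) (sub_nonneg.2 ?_))
      gcongr
      linarith
    have h3 : (assignmentWeight v Q X : ℝ) ≤
        2 * (2 * Q.card + X.card).choose X.card * N ! := by
      exact_mod_cast assignmentWeight_le_choose hv hN
    exact h3.trans (mul_le_mul_of_nonneg_right
      (le_mul_of_one_le_right (by positivity) h2) (by positivity))
  | insert x Y hx ih =>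
    have hdis := Finset.disjoint_insert_right.1 hXY
    have hxu : x ∉ X ∪ Y := by simp [hdis.1, hx]
    have hvx := hvY x (Finset.mem_insert_self x Y)
    obtain ⟨M, hM⟩ := Nat.exists_eq_add_of_le'
      (hv.two_add_card_le.trans (Nat.le_add_right _ (∑ x ∈ X ∪ Y, v x)))
    replace hM : ∑ c ∈ Q, v c + ∑ x ∈ X ∪ Y, v x = (M + 2) + Q.card := by omega
    have ih := ih hdis.2 (fun y hy => hvY y (Finset.mem_insert_of_mem hy)) hM
    rw [Finset.union_insert] at hN ⊢
    rw [Finset.sum_insert hxu] at hN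
    have hNM : N = M + 2 + v x := by omega
    have h1 := assignmentWeight_insert_le_of_two_le hv hM hxu hvx
    rw [hNM, ← Nat.factorial_mul_ascFactorial]
    generalize M + 2 = M at *
    have h2 : (assignmentWeight v Q (insert x (X ∪ Y)) : ℝ) ≤
        (1 + 6 * Q.card / (((M : ℝ) + 1) * (M + 2))) *
          ((M + 1).ascFactorial (v x) * assignmentWeight v Q (X ∪ Y)) := by
      have h1' : (((M : ℝ) + 1) * (M + 2)) * assignmentWeight v Q (insert x (X ∪ Y)) ≤
          (((M : ℝ) + 1) * (M + 2) + 6 * Q.card) * (M + 1).ascFactorial (v x) *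
            assignmentWeight v Q (X ∪ Y) := by exact_mod_cast h1
      rw [show (1 + 6 * Q.card / (((M : ℝ) + 1) * (M + 2))) =
        (((M : ℝ) + 1) * (M + 2) + 6 * Q.card) / (((M : ℝ) + 1) * (M + 2)) by field_simp,
        div_mul_eq_mul_div, le_div_iff₀ (by positivity)]
      linarith
    have h3 := one_add_mul_exp_le (C := 6 * Q.card) (by positivity) (1 / 3)
      (by omega : M + 1 ≤ M + v x)
    calc _ ≤ _ := h2
      _ ≤ (1 + 6 * Q.card / (((M : ℝ) + 1) * (M + 2))) * ((M + 1).ascFactorial (v x) *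
          (2 * (2 * Q.card + X.card).choose X.card *
            Real.exp (6 * Q.card * (1 / 3 - 1 / ((M : ℝ) + 1))) * M !)) := by gcongr
      _ = 2 * (2 * Q.card + X.card).choose X.card *
          ((1 + 6 * Q.card / (((M : ℝ) + 1) * (M + 2))) *
            Real.exp (6 * Q.card * (1 / 3 - 1 / ((M : ℝ) + 1)))) *
              (M ! * (M + 1).ascFactorial (v x)) := by ring
      _ ≤ _ := by
        push_cast at h3 ⊢
        gcongr

/-- If `Q ⊆ A` and `v ≥ 2` outside of `A`, then the assignment weight is at most the
factorial of the total excess, up to a factor exponential in `|A|`. -/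
lemma assignmentWeight_compl_le {A : Finset ι} (hQA : Q ⊆ A) (hv : HasTwoLarge v Q)
    (hvA : ∀ y ∉ A, 2 ≤ v y) {N : ℕ} (hN : ∑ x, v x = N + Q.card) :
    assignmentWeight v Q Qᶜ ≤ 2 ^ (5 * A.card + 1) * N ! := by
  have hX : A \ Q ∪ Aᶜ = Qᶜ := by
    ext x
    have := @hQA x
    simp only [Finset.mem_union, Finset.mem_sdiff, Finset.mem_compl]
    tauto
  have h := assignmentWeight_union_le (X := A \ Q) (Y := Aᶜ)
    (Finset.disjoint_left.2 fun x hx hx' =>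
      Finset.mem_compl.1 hx' (Finset.mem_sdiff.1 hx).1) hv
    (fun y hy => hvA y (Finset.mem_compl.1 hy)) (N := N)
    (by rw [hX, Finset.sum_add_sum_compl, hN])
  rw [hX] at h
  have hcard : (A \ Q).card + Q.card = A.card := Finset.card_sdiff_add_card_eq_card hQA
  have hexp : Real.exp (6 * Q.card * (1 / 3 - 1 / ((N : ℝ) + 1))) ≤ 2 ^ (3 * Q.card) := by
    refine le_trans (Real.exp_le_exp.2 ?_) (exp_le_two_pow _)
    have : 0 ≤ Q.card * (1 / ((N : ℝ) + 1)) := by positivity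
    linarith
  have hchoose : ((2 * Q.card + (A \ Q).card).choose (A \ Q).card : ℝ) ≤
      2 ^ (2 * Q.card + (A \ Q).card) := by exact_mod_cast Nat.choose_le_two_pow _ _
  have key : (assignmentWeight v Q Qᶜ : ℝ) ≤ 2 ^ (5 * A.card + 1) * N ! := by
    refine h.trans ?_
    gcongr
    calc _ ≤ (2 : ℝ) * 2 ^ (2 * Q.card + (A \ Q).card) * 2 ^ (3 * Q.card) := by gcongr
      _ = 2 ^ (1 + (2 * Q.card + (A \ Q).card) + 3 * Q.card) := by
        rw [pow_add 2 (1 + _), pow_add 2 1, pow_one]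
      _ ≤ _ := pow_le_pow_right₀ (by norm_num) (by omega)
  exact_mod_cast key

end Assignments

section Transversals

variable {ι G : Type*}

lemma exists_adj_dist_lt {Γ : SimpleGraph G} {g g₀ : G} (h : Γ.Reachable g g₀) (hg : g ≠ g₀) :
    ∃ g', Γ.Adj g g' ∧ Γ.dist g' g₀ < Γ.dist g g₀ := by
  obtain ⟨w, hw⟩ := h.exists_walk_length_eq_dist
  cases w with
  | nil => exact absurd rfl hg
  | cons hadj p =>
    refine ⟨_, hadj, (SimpleGraph.dist_le p).trans_lt ?_⟩
    rw [← hw, SimpleGraph.Walk.length_cons]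
    exact Nat.lt_succ_self _

variable [Fintype ι] [Fintype G]

/-- The set partition of `ι` into the fibers of a map `grp : ι → G`. -/
noncomputable def fiberPartition (grp : ι → G) : Finset (Finset ι) :=
  Finset.univ.image fun g => Finset.univ.filter fun x => grp x = g

lemma mem_fiberPartition {grp : ι → G} {s : Finset ι} :
    s ∈ fiberPartition grp ↔ ∃ g, Finset.univ.filter (fun x => grp x = g) = s := by
  simp [fiberPartition]

lemma card_fiberPartition {grp : ι → G} (hgrp : Function.Surjective grp) :
    (fiberPartition grp).card = Fintype.card G := by
  refine Finset.card_image_of_injective _ fun g h hgh => ?_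
  obtain ⟨x, rfl⟩ := hgrp g
  have hx : x ∈ Finset.univ.filter fun y => grp y = h := by
    rw [← hgh]
    simp
  simpa using hx

/-- Two indices are adjacent if some member of `α` meets both fibers of `grp`. -/
def fiberGraph (grp : ι → G) (α : Finset (Finset ι)) : SimpleGraph G where
  Adj g h := g ≠ h ∧ ∃ s ∈ α, ∃ x ∈ s, ∃ y ∈ s, grp x = g ∧ grp y = h
  symm := ⟨fun _ _ ⟨hgh, s, hs, x, hx, y, hy, hxg, hyh⟩ =>
    ⟨hgh.symm, s, hs, y, hy, x, hx, hyh, hxg⟩⟩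
  loopless := ⟨fun _ h => h.1 rfl⟩

variable [DecidableEq ι]

lemma fiberGraph_reachable {grp : ι → G} (hgrp : Function.Surjective grp)
    {α : Finset (Finset ι)} (hα : IsComplementary (fiberPartition grp) α) (g g₀ : G) :
    (fiberGraph grp α).Reachable g g₀ := by
  by_contra hg
  obtain ⟨R, mem_R⟩ : ∃ R : Finset ι, ∀ x, x ∈ R ↔ (fiberGraph grp α).Reachable (grp x) g₀ :=
    ⟨Finset.univ.filter _, fun x => Finset.mem_filter_univ x⟩
  obtain ⟨R', mem_R'⟩ : ∃ R' : Finset ι, ∀ x, x ∈ R' ↔ x ∉ R :=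
    ⟨Finset.univ.filter _, fun x => Finset.mem_filter_univ x⟩
  obtain ⟨γ, mem_γ⟩ : ∃ γ : Finset (Finset ι), ∀ s, s ∈ γ ↔ s = R ∨ s = R' :=
    ⟨{R, R'}, by simp⟩
  obtain ⟨x, rfl⟩ := hgrp g
  obtain ⟨x₀, rfl⟩ := hgrp g₀
  have hx : x ∉ R := fun h => hg ((mem_R x).1 h)
  have hx₀ : x₀ ∈ R := (mem_R x₀).2 .rfl
  have hrefines : ∀ s : Finset ι, (∀ y ∈ s, ∀ z ∈ s, y ∈ R → z ∈ R) → ∃ t ∈ γ, s ⊆ t := by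
    intro s hs
    by_cases h : ∃ y ∈ s, y ∈ R
    · obtain ⟨y, hy, hyR⟩ := h
      exact ⟨R, (mem_γ R).2 (Or.inl rfl), fun z hz => hs y hy z hz hyR⟩
    · push Not at h
      exact ⟨R', (mem_γ R').2 (Or.inr rfl), fun z hz => (mem_R' z).2 (h z hz)⟩
  have key := hα.2 γ ⟨fun s hs => ⟨Finset.subset_univ s, ?_⟩, fun y _ => ?_⟩
    (fun s hs => hrefines s ?_) (fun s hs => hrefines s ?_)
  · have h1 : R ∈ ({Finset.univ} : Finset (Finset ι)) := key ▸ (mem_γ R).2 (Or.inl rfl)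
    rw [Finset.mem_singleton] at h1
    exact hx (h1 ▸ Finset.mem_univ x)
  · rcases (mem_γ s).1 hs with rfl | rfl
    · exact Finset.ne_empty_of_mem hx₀
    · exact Finset.ne_empty_of_mem ((mem_R' x).2 hx)
  · by_cases hy : y ∈ R
    · refine ⟨R, ⟨(mem_γ R).2 (Or.inl rfl), hy⟩, fun t ht => ?_⟩
      exact ((mem_γ t).1 ht.1).resolve_right fun h => (mem_R' y).1 (h ▸ ht.2) hy
    · refine ⟨R', ⟨(mem_γ R').2 (Or.inr rfl), (mem_R' y).2 hy⟩, fun t ht => ?_⟩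
      exact ((mem_γ t).1 ht.1).resolve_left fun h => hy (h ▸ ht.2)
  · obtain ⟨g, rfl⟩ := mem_fiberPartition.1 hs
    intro y hy z hz
    rw [Finset.mem_filter] at hy hz
    rw [mem_R, mem_R, hy.2, hz.2]
    exact id
  · intro y hy z hz hyR
    rw [mem_R] at hyR ⊢
    by_cases hyz : grp z = grp y
    · rwa [hyz]
    · have hadj : (fiberGraph grp α).Adj (grp z) (grp y) := ⟨hyz, s, hs, z, hz, y, hy, rfl, rfl⟩
      exact hadj.reachable.trans hyR

/-- Given a set partition `α` complementary to the fibers of `grp`, one can choose one point in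
each fiber except the one over `g₀` such that the remaining points form a transversal of `α`.
Here `q` sends each point to the representative of its component. -/
lemma exists_transversal {grp : ι → G} (hgrp : Function.Surjective grp) (g₀ : G)
    {α : Finset (Finset ι)} (hαp : IsSetPartitionOn Finset.univ α)
    (hα : IsComplementary (fiberPartition grp) α) :
    ∃ (Q : Finset ι) (q : ι → ι), (∀ x, q x ∈ Q) ∧ (∀ x ∈ Q, q x = x) ∧
      (∀ x, grp x = g₀ → x ∈ Q) ∧ (∀ g ≠ g₀, ∃ x, grp x = g ∧ x ∉ Q) ∧ Q.card = α.card ∧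
      α = Q.image fun c => Finset.univ.filter fun x => q x = c := by
  have hblock : ∀ x, ∃ s ∈ α, x ∈ s := fun x => (hαp.2 x (Finset.mem_univ x)).exists
  choose B hBα hB using hblock
  have hBeq : ∀ {s x}, s ∈ α → x ∈ s → B x = s := fun hs hx =>
    hαp.eq_of_mem (hBα _) hs (hB _) hx
  set d : ι → ℕ := fun x => (fiberGraph grp α).dist (grp x) g₀
  have hp : ∀ g, ∃ x, grp x = g ∧ (g ≠ g₀ → ∃ y ∈ B x, d y < d x) := by
    intro g
    by_cases hg : g = g₀
    · obtain ⟨x, hx⟩ := hgrp g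
      exact ⟨x, hx, fun h => absurd hg h⟩
    · obtain ⟨g', ⟨-, s, hs, x, hx, y, hy, hxg, hyg⟩, hlt⟩ :=
        exists_adj_dist_lt (fiberGraph_reachable hgrp hα g g₀) hg
      refine ⟨x, hxg, fun _ => ⟨y, by rwa [hBeq hs hx], ?_⟩⟩
      simpa only [d, hxg, hyg] using hlt
  choose p hpg hpd using hp
  set Q : Finset ι := ((Finset.univ.erase g₀).image p)ᶜ with hQ
  have hpinj : Function.Injective p := Function.LeftInverse.injective hpg
  have hpQ : ∀ g, g ≠ g₀ → p g ∉ Q := fun g hg => by simpa [hQ] using ⟨g, hg, rfl⟩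
  have hcard : Q.card = α.card := by
    have h1 := hα.1
    rw [card_fiberPartition hgrp] at h1
    have h2 : Q.card + ((Finset.univ.erase g₀).image p).card = Fintype.card ι :=
      Finset.card_compl_add_card _
    rw [Finset.card_image_of_injective _ hpinj, Finset.card_erase_of_mem (Finset.mem_univ _),
      Finset.card_univ] at h2
    have h3 : 0 < Fintype.card G := Fintype.card_pos_iff.2 ⟨g₀⟩
    omega
  have hne : Nonempty ι := ⟨p g₀⟩
  have hc : ∀ s ∈ α, ∃ c ∈ s, c ∈ Q := by
    intro s hs
    obtain ⟨c, hcs, hmin⟩ :=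
      s.exists_min_image d (Finset.nonempty_iff_ne_empty.2 (hαp.1 s hs).2)
    refine ⟨c, hcs, ?_⟩
    by_contra hcQ
    obtain ⟨g, hg, rfl⟩ : ∃ g, g ≠ g₀ ∧ p g = c := by simpa [hQ] using hcQ
    obtain ⟨y, hy, hlt⟩ := hpd g hg
    rw [hBeq hs hcs] at hy
    exact (hmin y hy).not_gt hlt
  choose! c hcs hcQ using hc
  have hcinj : Set.InjOn c α := fun s hs t ht hst =>
    hαp.eq_of_mem hs ht (hcs s hs) (hst ▸ hcs t ht)
  have hQα : α.image c = Q := by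
    refine Finset.eq_of_subset_of_card_le (Finset.image_subset_iff.2 hcQ) ?_
    rw [Finset.card_image_of_injOn hcinj, hcard]
  have hfiber : ∀ s ∈ α, s = Finset.univ.filter fun x => c (B x) = c s := by
    intro s hs
    ext x
    rw [Finset.mem_filter]
    refine ⟨fun hx => ⟨Finset.mem_univ _, by rw [hBeq hs hx]⟩, fun hx => ?_⟩
    rw [← hcinj (hBα x) hs hx.2]
    exact hB x
  refine ⟨Q, fun x => c (B x), fun x => hcQ _ (hBα x), fun x hx => ?_, fun x hx => ?_,
    fun g hg => ⟨p g, hpg g, hpQ g hg⟩, hcard, ?_⟩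
  · rw [← hQα] at hx
    obtain ⟨s, hs, rfl⟩ := Finset.mem_image.1 hx
    exact congrArg c (hBeq hs (hcs s hs))
  · rw [hQ, Finset.mem_compl, Finset.mem_image]
    rintro ⟨g, hg, rfl⟩
    exact (Finset.mem_erase.1 hg).1 ((hpg g).symm.trans hx)
  · rw [← hQα, Finset.image_image]
    ext s
    rw [Finset.mem_image]
    constructor
    · exact fun hs => ⟨s, hs, (hfiber s hs).symm⟩
    · rintro ⟨t, ht, rfl⟩
      rw [Function.comp_apply, ← hfiber t ht]
      exact ht

end Transversals

section Main

variable {ι G : Type*} [Fintype ι] [DecidableEq ι] [Fintype G]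

lemma abs_prod_innerSingle_le {α : Finset (Finset ι)} (hα : IsSetPartitionOn Finset.univ α)
    {A : Finset ι} (hαA : ∀ s ∈ α, (s ∩ A).Nonempty) {v : ι → ℕ} (hv : ∀ y, 1 ≤ v y)
    (hvA : ∀ y ∉ A, 2 ≤ v y) :
    |∏ s ∈ α, innerSingle s v| ≤
      2 ^ (4 * A.card + 64 * α.card) * ((∏ s ∈ α, (∑ x ∈ s, v x)! : ℕ) : ℝ) := by
  have hA : ∑ s ∈ α, (s ∩ A).card = A.card := by
    have h := hα.sum_sum fun x => if x ∈ A then 1 else 0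
    simpa [Finset.sum_boole, Finset.filter_mem_eq_inter] using h
  rw [Finset.abs_prod]
  calc ∏ s ∈ α, |innerSingle s v|
      ≤ ∏ s ∈ α, (2 ^ (4 * (s ∩ A).card + 64) * ((∑ x ∈ s, v x)! : ℝ)) :=
        Finset.prod_le_prod (fun _ _ => abs_nonneg _)
          fun s hs => abs_innerSingle_le (hαA s hs) hv hvA
    _ = _ := by
        rw [Finset.prod_mul_distrib, Finset.prod_pow_eq_pow_sum, Finset.sum_add_distrib,
          ← Finset.mul_sum, hA, Finset.sum_const, smul_eq_mul, mul_comm α.card]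
        push_cast
        rfl

/-- Bound for the inner product of a family of partitions, the partition over `g₀` having at
least two parts which are at least `2`. Here `A` contains all parts except some which are the
only part of their partition, and are at least `2`. -/
lemma abs_innerMulti_fiberPartition_le {grp : ι → G} (hgrp : Function.Surjective grp) (g₀ : G)
    {v : ι → ℕ} (hv : ∀ y, 1 ≤ v y)
    (hbig : ∃ p q, p ≠ q ∧ grp p = g₀ ∧ grp q = g₀ ∧ 2 ≤ v p ∧ 2 ≤ v q)
    {A : Finset ι} (hvA : ∀ y ∉ A, 2 ≤ v y) (hA : ∀ y ∉ A, ∀ x, grp x = grp y → x = y)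
    (hcard : Fintype.card ι + 1 ≤ A.card + Fintype.card G) {N : ℕ}
    (hN : ∑ x, v x + Fintype.card G = N + (Fintype.card ι + 1)) :
    |innerMulti (fiberPartition grp) v| ≤ 2 ^ (74 * A.card + 1) * (N ! : ℝ) := by
  set T : Finset ((_ : Finset ι) × (ι → ι)) :=
    (A.powerset.filter fun Q => HasTwoLarge v Q ∧ ∑ x, v x = N + Q.card).sigma
      fun Q => assignments Q Qᶜ with hT
  set F : (_ : Finset ι) × (ι → ι) → Finset (Finset ι) := fun y =>
    y.1.image fun c => Finset.univ.filter fun x => y.2 x = c with hF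
  have key : ∀ α ∈ Finset.univ.filter (fun α : Finset (Finset ι) =>
      IsSetPartitionOn Finset.univ α ∧ IsComplementary (fiberPartition grp) α),
      (α.card ≤ A.card ∧ ∀ s ∈ α, (s ∩ A).Nonempty) ∧ ∃ y ∈ T, F y = α := by
    intro α hα
    rw [Finset.mem_filter_univ] at hα
    obtain ⟨Q, q, hqQ, hq, hroot, hmove, hQα, hαQ⟩ :=
      exists_transversal hgrp g₀ hα.1 hα.2
    have hαcard := hα.2.1
    rw [card_fiberPartition hgrp] at hαcard
    obtain ⟨p, p', hpp', hp, hp', hvp, hvp'⟩ := hbig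
    have hQA : Q ⊆ A := by
      intro y hyQ
      by_contra hyA
      by_cases hy : grp y = g₀
      · exact hpp' ((hA y hyA p (hp.trans hy.symm)).trans
          (hA y hyA p' (hp'.trans hy.symm)).symm)
      · obtain ⟨x, hxy, hx⟩ := hmove _ hy
        exact hx (hA y hyA x hxy ▸ hyQ)
    refine ⟨⟨by omega, fun s hs => ?_⟩, ⟨Q, q⟩, ?_, hαQ.symm⟩
    · rw [hαQ] at hs
      obtain ⟨c, hc, rfl⟩ := Finset.mem_image.1 hs
      exact ⟨c, Finset.mem_inter.2 ⟨(Finset.mem_filter_univ c).2 (hq c hc), hQA hc⟩⟩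
    · refine Finset.mem_sigma.2 ⟨Finset.mem_filter.2 ⟨Finset.mem_powerset.2 hQA,
        ⟨hv, p, hroot p hp, p', hroot p' hp', hpp', hvp, hvp'⟩, by
          dsimp only
          omega⟩,
        mem_assignments.2 ⟨fun x _ => hqQ x, fun x hx => hq x ?_⟩⟩
      simpa using hx
  have hsum := sum_le_sum_of_forall_exists_eq F (fun α => ∏ s ∈ α, (∑ x ∈ s, v x)!)
    fun α hα => (key α hα).2
  have hterm : ∀ Q, ∀ q ∈ assignments Q Qᶜ, ∏ s ∈ F ⟨Q, q⟩, (∑ x ∈ s, v x)! =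
      ∏ c ∈ Q, (assignedValue v Qᶜ q c)! := by
    intro Q q hq
    rw [mem_assignments] at hq
    have hfix : ∀ c ∈ Q, q c = c := fun c hc => hq.2 c (by simpa using hc)
    rw [hF, Finset.prod_image]
    · refine Finset.prod_congr rfl fun c hc => ?_
      congr 1
      rw [assignedValue, ← Finset.sum_filter_add_sum_filter_not _ (· ∈ Q),
        Finset.filter_filter, Finset.filter_filter]
      congr 1
      · have : (Finset.univ.filter fun x => q x = c ∧ x ∈ Q) = {c} := by
          ext x
          rw [Finset.mem_filter_univ, Finset.mem_singleton]
          refine ⟨fun h => (hfix x h.2).symm.trans h.1, ?_⟩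
          rintro rfl
          exact ⟨hfix x hc, hc⟩
        rw [this, Finset.sum_singleton]
      · refine Finset.sum_congr ?_ fun _ _ => rfl
        ext x
        simp [and_comm]
    · intro c hc c' hc' h
      have h' : c ∈ Finset.univ.filter fun x => q x = c' := by
        have h0 : (Finset.univ.filter fun x => q x = c) = Finset.univ.filter fun x => q x = c' := h
        rw [← h0]
        simpa using hfix c hc
      rw [Finset.mem_filter_univ, hfix c hc] at h'
      exact h'
  have hcount : ∑ y ∈ T, ∏ s ∈ F y, (∑ x ∈ s, v x)! ≤
      2 ^ A.card * (2 ^ (5 * A.card + 1) * N !) := by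
    rw [hT, Finset.sum_sigma]
    calc _ ≤ ∑ Q ∈ A.powerset.filter fun Q => HasTwoLarge v Q ∧ ∑ x, v x = N + Q.card,
          2 ^ (5 * A.card + 1) * N ! := by
          refine Finset.sum_le_sum fun Q hQ => ?_
          rw [Finset.mem_filter, Finset.mem_powerset] at hQ
          rw [Finset.sum_congr rfl (hterm Q)]
          exact assignmentWeight_compl_le hQ.1 hQ.2.1 hvA hQ.2.2
      _ ≤ _ := by
          rw [Finset.sum_const, smul_eq_mul, ← Finset.card_powerset]
          exact Nat.mul_le_mul_right _ (Finset.card_filter_le _ _)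
  rw [innerMulti]
  calc _ ≤ ∑ α ∈ Finset.univ.filter (fun α : Finset (Finset ι) =>
          IsSetPartitionOn Finset.univ α ∧ IsComplementary (fiberPartition grp) α),
        2 ^ (68 * A.card) * ((∏ s ∈ α, (∑ x ∈ s, v x)! : ℕ) : ℝ) := by
        refine (Finset.abs_sum_le_sum_abs _ _).trans (Finset.sum_le_sum fun α hα => ?_)
        obtain ⟨⟨h1, h2⟩, -⟩ := key α hα
        refine (abs_prod_innerSingle_le ((Finset.mem_filter_univ α).1 hα).1 h2 hv hvA).trans ?_
        gcongr
        · norm_num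
        · omega
    _ ≤ 2 ^ (68 * A.card) * ((2 ^ A.card * (2 ^ (5 * A.card + 1) * N !) : ℕ) : ℝ) := by
        rw [← Finset.mul_sum, ← Nat.cast_sum]
        gcongr
        exact hsum.trans hcount
    _ = _ := by
        push_cast
        ring

end Main

/-- Let `a ≥ 1` and `b ≥ 0`; let `λ^(1), …, λ^(a)` be partitions of
lengths `ℓ₁, …, ℓ_a ≥ 2` (nonincreasing tuples of positive integers) and let
`D₁, …, D_b ≥ 2`.  With `L = Σ ℓ_i`, `|λ| = Σ |λ^(i)|`, and `B = Σ D_j`, suppose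
additionally that some `λ^(j₀)` has at least two parts `≥ 2`.  Then
`|⟨p_{λ^(1)} | ⋯ | p_{λ^(a)} | p_{D₁} | ⋯ | p_{D_b}⟩| ≤ 2^{89L+5} (|λ| + a + B − L − 1)!`.
Here the ground set is `(Σ i, Fin ℓ_i) ⊕ Fin b`, the set partition `ρ` consists of the
fibers of the grouping map (one component per `λ^(i)` and a singleton per `D_j`), and
the value map records the parts. -/
theorem abs_innerMulti_le_of_two_large_parts (a b : ℕ) (ha : 1 ≤ a)
    (l : Fin a → ℕ) (hl : ∀ i, 2 ≤ l i)
    (lam : (i : Fin a) → Fin (l i) → ℕ)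
    (hpos : ∀ i j, 0 < lam i j)
    (hanti : ∀ (i : Fin a), ∀ j j' : Fin (l i), j ≤ j' → lam i j' ≤ lam i j)
    (hbig : ∃ j₀ : Fin a, ∃ p q : Fin (l j₀), p ≠ q ∧ 2 ≤ lam j₀ p ∧ 2 ≤ lam j₀ q)
    (D : Fin b → ℕ) (hD : ∀ j, 2 ≤ D j) :
    |innerMulti
        (Finset.univ.image fun g : Fin a ⊕ Fin b =>
          Finset.univ.filter fun x : (Σ i : Fin a, Fin (l i)) ⊕ Fin b =>
            Sum.map Sigma.fst id x = g)
        (Sum.elim (fun x => lam x.1 x.2) D)| ≤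
      2 ^ (89 * (∑ i, l i) + 5) *
        (((∑ i, ∑ j, lam i j) + a + (∑ j, D j) - (∑ i, l i) - 1)! : ℝ) := by
  obtain ⟨j₀, p, q, hpq, hp, hq⟩ := hbig
  set A : Finset ((Σ i : Fin a, Fin (l i)) ⊕ Fin b) :=
    Finset.univ.map Function.Embedding.inl with hA
  have hAcard : A.card = ∑ i, l i := by simp [hA]
  have hL : ∑ i, l i ≤ ∑ i, ∑ j, lam i j :=
    Finset.sum_le_sum fun i _ => by
      simpa using Finset.sum_le_sum fun j (_ : j ∈ Finset.univ) => Nat.one_le_iff_ne_zero.2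
        (hpos i j).ne'
  have haL : 2 * a ≤ ∑ i, l i := by
    simpa [mul_comm] using Finset.sum_le_sum fun i (_ : i ∈ Finset.univ) => hl i
  have hnot : ∀ y ∉ A, ∃ j, y = Sum.inr j := by
    rintro (y | j) hy
    · exact absurd (by simp [hA]) hy
    · exact ⟨j, rfl⟩
  have hcardι : Fintype.card ((Σ i : Fin a, Fin (l i)) ⊕ Fin b) = ∑ i, l i + b := by simp
  have hcardG : Fintype.card (Fin a ⊕ Fin b) = a + b := by simp
  have main := abs_innerMulti_fiberPartition_le
    (grp := (Sum.map Sigma.fst id : (Σ i : Fin a, Fin (l i)) ⊕ Fin b → Fin a ⊕ Fin b))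
    (Sum.map_surjective.2 ⟨fun i => ⟨⟨i, ⟨0, by have := hl i; omega⟩⟩, rfl⟩,
      Function.surjective_id⟩) (Sum.inl j₀) (v := Sum.elim (fun x => lam x.1 x.2) D)
    (by
      rintro (y | j)
      · exact hpos _ _
      · exact one_le_two.trans (hD j))
    ⟨Sum.inl ⟨j₀, p⟩, Sum.inl ⟨j₀, q⟩, by simpa using hpq, rfl, rfl, hp, hq⟩ (A := A)
    (fun y hy => by
      obtain ⟨j, rfl⟩ := hnot y hy
      exact hD j)
    (fun y hy x hx => by
      obtain ⟨j, rfl⟩ := hnot y hy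
      cases x <;> simp_all)
    (by omega)
    (N := (∑ i, ∑ j, lam i j) + a + (∑ j, D j) - (∑ i, l i) - 1)
    (by
      rw [Fintype.sum_sum_type, Fintype.sum_sigma]
      simp only [Sum.elim_inl, Sum.elim_inr]
      omega)
  refine le_trans (le_of_eq ?_) (main.trans ?_)
  · unfold fiberPartition
    congr!
  · rw [hAcard]
    gcongr
    · norm_num
    · omega
    · norm_num
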